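/- arXiv:0902.1935 — 2 statements merged into one kernel-verified Lean document; each statement's English description precedes it below -/
import Mathlib

section
/- (Resolvent identity for the singular perturbation.) Let T, G ∈ Mat(2L,ℂ) be such that T + 1 is invertible and the matrix T·(G − (1/2)J) − (G + (1/2)J) = (T − 1)·G − (1/2)(T + 1)·J is invertible. Define K := [T·(G − (1/2)J) − (G + (1/2)J)]⁻¹·(1 − T). Then 1 + K·G is invertible and (1 + K·G)⁻¹·K = −2·J·(T + 1)⁻¹·(T − 1). Consequently, if in addition G is invertible and G⁻¹ + V̂ is invertible where V̂ := 2·J·(T + 1)⁻¹·(T − 1), then G·(1 + K·G) = (G⁻¹ + V̂)⁻¹. -/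
open Matrix

noncomputable section

/-- The `2L × 2L` matrix `J = [[0, -1],[1, 0]]`, with index type `Fin L ⊕ Fin L`. -/
def Jmat (L : ℕ) : Matrix (Fin L ⊕ Fin L) (Fin L ⊕ Fin L) ℂ :=
  Matrix.fromBlocks 0 (-1) 1 0

/-- `J` squares to `-1`. -/
theorem Jmat_mul_Jmat (L : ℕ) : Jmat L * Jmat L = -1 := by
  simp [Jmat, Matrix.fromBlocks_multiply, ← Matrix.fromBlocks_one, Matrix.fromBlocks_neg]

/-- resolvent identity for the singular perturbation. -/
theorem resolvent_identity_singular_perturbation (L : ℕ) (hL : 0 < L)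
    (T G : Matrix (Fin L ⊕ Fin L) (Fin L ⊕ Fin L) ℂ)
    (hT1 : IsUnit (T + 1))
    (hB : IsUnit (T * (G - ((1:ℂ)/2) • Jmat L) - (G + ((1:ℂ)/2) • Jmat L)))
    (K : Matrix (Fin L ⊕ Fin L) (Fin L ⊕ Fin L) ℂ)
    (hK : K = (T * (G - ((1:ℂ)/2) • Jmat L) - (G + ((1:ℂ)/2) • Jmat L))⁻¹ * (1 - T)) :
    (T * (G - ((1:ℂ)/2) • Jmat L) - (G + ((1:ℂ)/2) • Jmat L) =
      (T - 1) * G - ((1:ℂ)/2) • ((T + 1) * Jmat L)) ∧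
    IsUnit (1 + K * G) ∧
    (1 + K * G)⁻¹ * K = -((2:ℂ) • (Jmat L * (T + 1)⁻¹ * (T - 1))) ∧
    (IsUnit G → IsUnit (G⁻¹ + (2:ℂ) • (Jmat L * (T + 1)⁻¹ * (T - 1))) →
      G * (1 + K * G) = (G⁻¹ + (2:ℂ) • (Jmat L * (T + 1)⁻¹ * (T - 1)))⁻¹) := by
  have hB_eq : T * (G - ((1:ℂ)/2) • Jmat L) - (G + ((1:ℂ)/2) • Jmat L) =
      (T - 1) * G - ((1:ℂ)/2) • ((T + 1) * Jmat L) := by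
    simp only [mul_sub, sub_mul, add_mul, one_mul, Matrix.mul_smul, smul_add]
    abel
  refine ⟨hB_eq, ?_⟩
  rw [hB_eq] at hB hK
  set B := (T - 1) * G - ((1:ℂ)/2) • ((T + 1) * Jmat L) with hB_def
  have hB_inv : B⁻¹ * B = 1 := Matrix.nonsing_inv_mul _ ((Matrix.isUnit_iff_isUnit_det _).1 hB)
  have hB_inv' : B * B⁻¹ = 1 := Matrix.mul_nonsing_inv _ ((Matrix.isUnit_iff_isUnit_det _).1 hB)
  have hT_inv : (T + 1) * (T + 1)⁻¹ = 1 :=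
    Matrix.mul_nonsing_inv _ ((Matrix.isUnit_iff_isUnit_det _).1 hT1)
  have hKG : 1 + K * G = -(((1:ℂ)/2) • (B⁻¹ * ((T + 1) * Jmat L))) := by
    have hsum : B + (1 - T) * G = -(((1:ℂ)/2) • ((T + 1) * Jmat L)) := by
      rw [hB_def]; noncomm_ring
    calc 1 + K * G = B⁻¹ * (B + (1 - T) * G) := by
          rw [hK, mul_add, hB_inv, Matrix.mul_assoc]
      _ = _ := by rw [hsum, mul_neg, Matrix.mul_smul]
  have hright : (1 + K * G) * ((2:ℂ) • (Jmat L * (T + 1)⁻¹ * B)) = 1 := by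
    calc (1 + K * G) * ((2:ℂ) • (Jmat L * (T + 1)⁻¹ * B))
        = -(B⁻¹ * ((T + 1) * (Jmat L * Jmat L) * (T + 1)⁻¹ * B)) := by
          rw [hKG, neg_mul, Matrix.smul_mul, Matrix.mul_smul, smul_smul]
          norm_num [Matrix.mul_assoc]
      _ = 1 := by
          rw [Jmat_mul_Jmat, mul_neg, mul_one, neg_mul, hT_inv, neg_mul, one_mul, mul_neg, neg_neg,
            hB_inv]
  have hunit : IsUnit (1 + K * G) := IsUnit.of_mul_eq_one _ hright
  have hres : (1 + K * G)⁻¹ * K = -((2:ℂ) • (Jmat L * (T + 1)⁻¹ * (T - 1))) := by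
    rw [Matrix.inv_eq_right_inv hright, Matrix.smul_mul, ← smul_neg]
    congr 1
    rw [hK, Matrix.mul_assoc, ← Matrix.mul_assoc B, hB_inv', Matrix.one_mul, ← mul_neg, neg_sub]
  refine ⟨hunit, hres, fun hG _ => ?_⟩
  have hG_inv : G * G⁻¹ = 1 := Matrix.mul_nonsing_inv _ ((Matrix.isUnit_iff_isUnit_det _).1 hG)
  have hK_eq : (1 + K * G) * ((2:ℂ) • (Jmat L * (T + 1)⁻¹ * (T - 1))) = -K := by
    rw [← neg_eq_iff_eq_neg, ← mul_neg, ← hres, ← Matrix.mul_assoc,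
      Matrix.mul_nonsing_inv _ ((Matrix.isUnit_iff_isUnit_det _).1 hunit), Matrix.one_mul]
  refine (Matrix.inv_eq_left_inv ?_).symm
  rw [Matrix.mul_assoc, mul_add (1 + K * G), hK_eq, add_mul, Matrix.mul_assoc K, hG_inv]
  simp [hG_inv]
end
end

section
/- (Cayley transform of a hermitian symplectic, orthogonal matrix.) Let T ∈ Mat(2L,ℂ) satisfy T*·J·T = J and Tᵗ·T = 1, and suppose T + 1 is invertible. Then the Cayley transform V̂ := 2·J·(T + 1)⁻¹·(T − 1) satisfies V̂* = V̂ and J*·V̂ᵗ·J = V̂. -/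
open Matrix

noncomputable section

/-- If `A * J * T = J`, the Cayley transforms `C` of `T` and `D` of `A` are intertwined by `J`
up to a sign. -/
theorem cayley_intertwine {R : Type*} [Ring R] {A T J C D : R} (h : A * J * T = J)
    (hA : IsUnit (A + 1)) (hT : IsUnit (T + 1))
    (hD : (A + 1) * D = A - 1) (hC : C * (T + 1) = T - 1) : D * J = -(J * C) := by
  refine hA.mul_left_cancel (hT.mul_right_cancel ?_)
  calc (A + 1) * (D * J) * (T + 1) = (A - 1) * J * (T + 1) := by
        rw [← mul_assoc, hD]
    _ = -((A + 1) * J * (T - 1)) := by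
        simp only [add_mul, sub_mul, mul_add, mul_sub, one_mul, mul_one, h]
        abel
    _ = (A + 1) * -(J * C) * (T + 1) := by
        rw [← hC]
        simp only [mul_neg, neg_mul, mul_assoc]

theorem Jmat_conjTranspose (L : ℕ) : (Jmat L)ᴴ = -Jmat L := by
  simp [Jmat, Matrix.fromBlocks_conjTranspose, Matrix.fromBlocks_neg]

theorem Jmat_transpose_mul_self (L : ℕ) : (Jmat L)ᵀ * Jmat L = 1 := by
  simp [Jmat, Matrix.fromBlocks_transpose, Matrix.fromBlocks_multiply]

/-- the Cayley transform `V̂ = 2 J (T+1)⁻¹ (T−1)` of a hermitian symplectic,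
orthogonal matrix `T` is hermitian and self-dual. -/
theorem cayley_transform_selfDual (L : ℕ) (hL : 0 < L)
    (T : Matrix (Fin L ⊕ Fin L) (Fin L ⊕ Fin L) ℂ)
    (hT : Tᴴ * Jmat L * T = Jmat L)
    (hTo : Tᵀ * T = 1)
    (hT1 : IsUnit (T + 1)) :
    ((2:ℂ) • (Jmat L * (T + 1)⁻¹ * (T - 1)))ᴴ = (2:ℂ) • (Jmat L * (T + 1)⁻¹ * (T - 1)) ∧
    (Jmat L)ᴴ * ((2:ℂ) • (Jmat L * (T + 1)⁻¹ * (T - 1)))ᵀ * Jmat L =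
      (2:ℂ) • (Jmat L * (T + 1)⁻¹ * (T - 1)) := by
  have hdet : IsUnit (T + 1).det := (Matrix.isUnit_iff_isUnit_det _).mp hT1
  rw [Matrix.mul_assoc (Jmat L)]
  set C := (T + 1)⁻¹ * (T - 1)
  have hC : C * (T + 1) = T - 1 := by
    have hcomm : (T - 1) * (T + 1) = (T + 1) * (T - 1) := by noncomm_ring
    rw [Matrix.mul_assoc, hcomm, Matrix.nonsing_inv_mul_cancel_left _ _ hdet]
  have hstar : Cᴴ * Jmat L = -(Jmat L * C) := by
    refine cayley_intertwine hT ?_ hT1 ?_ hC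
    · simpa [Matrix.star_eq_conjTranspose] using hT1.star
    · simpa using congrArg Matrix.conjTranspose hC
  have htranspose : Cᵀ = -C := by
    have h := cayley_intertwine (A := Tᵀ) (J := 1) (D := Cᵀ) (by rwa [mul_one]) ?_ hT1 ?_ hC
    · simpa using h
    · simpa using Matrix.isUnit_transpose (T + 1) |>.mpr hT1
    · simpa using congrArg Matrix.transpose hC
  constructor
  · simp [Matrix.conjTranspose_smul, Jmat_conjTranspose, hstar]
  · simp [Jmat_conjTranspose, htranspose, Matrix.mul_assoc, Jmat_transpose_mul_self]
end
end
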